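/- Let N ≥ 1, S = {1,…,N}, p ∈ (0,1)^N with weights w_i = p_i/(1−p_i), and let z be an integer with 0 ≤ z ≤ N. Define F(p) = R(z, S) · ∏_{j=1}^N (1−p_j) (the Poisson binomial probability of exactly z successes). Then for each i, ∂/∂p_i log F(p) = ((1+w_i)²/w_i) · π_i − (1+w_i), where π_i = w_i R(z−1, S∖{i}) / R(z, S). -/

import Mathlib

open Finset

/-- The R-function: `R(k, A) = ∑_{B ⊆ A, |B| = k} ∏_{i ∈ B} w i`, with
`R(0, A) = 1` and `R(k, A) = 0` for `k < 0` or `k > |A|`. -/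
noncomputable def Rfun {ι : Type*} [DecidableEq ι] (w : ι → ℝ) (k : ℤ) (A : Finset ι) : ℝ :=
  if k < 0 then 0 else ∑ B ∈ A.powersetCard k.toNat, ∏ i ∈ B, w i

/-- Bernoulli weights `w_j = p_j / (1 − p_j)`. -/
noncomputable def wOf {N : ℕ} (p : Fin N → ℝ) : Fin N → ℝ := fun j => p j / (1 - p j)

/-- The Poisson binomial probability of exactly `z` successes:
`F(p) = R(z, S) ∏_{j=1}^N (1 − p_j)`. -/
noncomputable def pbProb (N : ℕ) (z : ℕ) (p : Fin N → ℝ) : ℝ :=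
  Rfun (wOf p) (z : ℤ) Finset.univ * ∏ j, (1 - p j)

/-- First-order inclusion probability `π_i = w_i R(z−1, S∖{i}) / R(z, S)`. -/
noncomputable def piOf {N : ℕ} (p : Fin N → ℝ) (z : ℕ) (i : Fin N) : ℝ :=
  wOf p i * Rfun (wOf p) ((z : ℤ) - 1) (Finset.univ.erase i) / Rfun (wOf p) (z : ℤ) Finset.univ

lemma Rfun_natCast {ι : Type*} [DecidableEq ι] (w : ι → ℝ) (k : ℕ) (A : Finset ι) :
    Rfun w (k : ℤ) A = ∑ B ∈ A.powersetCard k, ∏ i ∈ B, w i := by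
  simp [Rfun]

lemma Rfun_congr {ι : Type*} [DecidableEq ι] {w w' : ι → ℝ} (k : ℤ) {A : Finset ι}
    (h : ∀ i ∈ A, w i = w' i) : Rfun w k A = Rfun w' k A := by
  unfold Rfun
  split_ifs
  · rfl
  · refine sum_congr rfl fun B hB => prod_congr rfl fun i hi => h i ?_
    exact (mem_powersetCard.mp hB).1 hi

lemma Rfun_pos {ι : Type*} [DecidableEq ι] {w : ι → ℝ} {k : ℕ} {A : Finset ι}
    (hw : ∀ i ∈ A, 0 < w i) (hk : k ≤ #A) : 0 < Rfun w (k : ℤ) A := by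
  rw [Rfun_natCast]
  refine sum_pos (fun B hB => prod_pos fun i hi => hw i ?_) (powersetCard_nonempty.mpr hk)
  exact (mem_powersetCard.mp hB).1 hi

/-- Splitting the subsets of `insert i A` according to whether they contain `i`. -/
lemma Rfun_insert {ι : Type*} [DecidableEq ι] (w : ι → ℝ) (k : ℕ) {A : Finset ι} {i : ι}
    (hi : i ∉ A) :
    Rfun w (k : ℤ) (insert i A) = Rfun w (k : ℤ) A + w i * Rfun w ((k : ℤ) - 1) A := by
  cases k with
  | zero => simp [Rfun]
  | succ k =>
    have hk : ((k + 1 : ℕ) : ℤ) - 1 = (k : ℤ) := by push_cast; ring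
    have hmem : ∀ B ∈ A.powersetCard k, i ∉ B := fun B hB h =>
      hi ((mem_powersetCard.mp hB).1 h)
    rw [hk, Rfun_natCast, Rfun_natCast, Rfun_natCast, powersetCard_succ_insert hi, sum_union,
      sum_image, mul_sum]
    · congr 1
      exact sum_congr rfl fun B hB => prod_insert (hmem B hB)
    · intro B hB C hC h
      rw [← erase_insert (hmem B hB), ← erase_insert (hmem C hC), h]
    · rw [disjoint_left]
      intro B hB hB'
      obtain ⟨C, -, rfl⟩ := mem_image.mp hB'
      exact hi ((mem_powersetCard.mp hB).1 (mem_insert_self i C))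

lemma Rfun_univ {N : ℕ} (w : Fin N → ℝ) (k : ℕ) (i : Fin N) :
    Rfun w (k : ℤ) univ =
      Rfun w (k : ℤ) (univ.erase i) + w i * Rfun w ((k : ℤ) - 1) (univ.erase i) := by
  rw [← Rfun_insert w k (notMem_erase i univ), insert_erase (mem_univ i)]

lemma wOf_update_of_ne {N : ℕ} (p : Fin N → ℝ) {i j : Fin N} (h : j ≠ i) (t : ℝ) :
    wOf (Function.update p i t) j = wOf p j := by
  simp [wOf, h]

/-- The dependence of the Poisson binomial probability on a single success probability. -/
lemma pbProb_update {N : ℕ} (z : ℕ) (p : Fin N → ℝ) (i : Fin N) (t : ℝ) :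
    pbProb N z (Function.update p i t) =
      (Rfun (wOf p) (z : ℤ) (univ.erase i) +
        t / (1 - t) * Rfun (wOf p) ((z : ℤ) - 1) (univ.erase i)) *
      ((1 - t) * ∏ j ∈ univ.erase i, (1 - p j)) := by
  have hw : ∀ j ∈ univ.erase i, wOf (Function.update p i t) j = wOf p j := fun j hj =>
    wOf_update_of_ne p (ne_of_mem_erase hj) t
  have hprod : ∏ j ∈ univ.erase i, (1 - Function.update p i t j) =
      ∏ j ∈ univ.erase i, (1 - p j) :=
    prod_congr rfl fun j hj => by rw [Function.update_of_ne (ne_of_mem_erase hj)]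
  rw [pbProb, Rfun_univ _ z i, Rfun_congr _ hw, Rfun_congr _ hw,
    ← mul_prod_erase univ _ (mem_univ i), hprod]
  simp [wOf]

/-- for non-degenerate `p ∈ (0,1)^N` and `0 ≤ z ≤ N`,
`∂/∂p_i log F(p) = ((1+w_i)²/w_i) π_i − (1+w_i)`. -/
theorem stmt_10 (N : ℕ) (hN : 1 ≤ N) (p : Fin N → ℝ) (hp : ∀ i, p i ∈ Set.Ioo (0 : ℝ) 1)
    (z : ℕ) (hz : z ≤ N) (i : Fin N) :
    HasDerivAt (fun t : ℝ => Real.log (pbProb N z (Function.update p i t)))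
      ((1 + wOf p i) ^ 2 / wOf p i * piOf p z i - (1 + wOf p i)) (p i) := by
  have hq : ∀ j, 0 < 1 - p j := fun j => sub_pos.mpr (hp j).2
  have hw : ∀ j, 0 < wOf p j := fun j => div_pos (hp j).1 (hq j)
  have hR : 0 < Rfun (wOf p) (z : ℤ) univ := Rfun_pos (fun j _ => hw j) (by simpa using hz)
  have hC : 0 < ∏ j ∈ univ.erase i, (1 - p j) := prod_pos fun j _ => hq j
  have hwi : wOf p i = p i / (1 - p i) := rfl
  simp only [pbProb_update, piOf]
  rw [Rfun_univ _ z i, hwi] at hR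
  rw [Rfun_univ _ z i, hwi]
  generalize Rfun (wOf p) (z : ℤ) (univ.erase i) = a at *
  generalize Rfun (wOf p) ((z : ℤ) - 1) (univ.erase i) = b at *
  generalize ∏ j ∈ univ.erase i, (1 - p j) = c at *
  have hqi := hq i
  have hpi := (hp i).1
  generalize p i = x at *
  have hsub : HasDerivAt (fun t : ℝ => 1 - t) (-1) x := by
    simpa using (hasDerivAt_id x).const_sub 1
  have hodds := (hasDerivAt_id x).div hsub hqi.ne'
  have hF := ((hodds.mul_const b).const_add a).mul (hsub.mul_const c)
  have hlog := hF.log (mul_pos hR (mul_pos hqi hC)).ne'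
  refine hlog.congr_deriv ?_
  have h1 := hqi.ne'
  have h2 := hR.ne'
  simp only [id, Pi.mul_apply, Pi.div_apply]
  generalize a + x / (1 - x) * b = r at *
  field_simp
  ring
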